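/- Let k be a field with char(k) ≠ 2, 3, 5 and let q be a nondegenerate ternary quadratic form over k whose Gram matrix Q has determinant a nonzero square (discriminant 1). Then SO(q)(k) contains a subgroup isomorphic to the alternating group A₅ if and only if 5 is a square in k (∃ x ∈ k, x² = 5) and q is equivalent to q₀ = ⟨1,1,1⟩. -/

import Mathlib

open Matrix

/-- The special orthogonal group `SO(q)(k)` of a ternary quadratic form with Gram matrix `Q`,
realized as the subgroup of `GL (Fin 3) k` consisting of the matrices `M` with
`Mᵀ * Q * M = Q` and `det M = 1`. -/
def SO3 (k : Type) [Field k] (Q : Matrix (Fin 3) (Fin 3) k) :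
    Subgroup (GL (Fin 3) k) where
  carrier := {M | (M : Matrix (Fin 3) (Fin 3) k)ᵀ * Q * (M : Matrix (Fin 3) (Fin 3) k) = Q ∧
      (M : Matrix (Fin 3) (Fin 3) k).det = 1}
  one_mem' := by
    constructor
    · simp
    · simp
  mul_mem' := by
    rintro A B ⟨hA, hA'⟩ ⟨hB, hB'⟩
    constructor
    · have hAB : ((A * B : GL (Fin 3) k) : Matrix (Fin 3) (Fin 3) k)
        = (A : Matrix (Fin 3) (Fin 3) k) * (B : Matrix (Fin 3) (Fin 3) k) := rfl
      rw [hAB, transpose_mul]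
      calc (B : Matrix (Fin 3) (Fin 3) k)ᵀ * (A : Matrix (Fin 3) (Fin 3) k)ᵀ * Q *
            ((A : Matrix (Fin 3) (Fin 3) k) * (B : Matrix (Fin 3) (Fin 3) k))
          = (B : Matrix (Fin 3) (Fin 3) k)ᵀ *
            ((A : Matrix (Fin 3) (Fin 3) k)ᵀ * Q * (A : Matrix (Fin 3) (Fin 3) k)) *
            (B : Matrix (Fin 3) (Fin 3) k) := by noncomm_ring
        _ = Q := by rw [hA, hB]
    · have hAB : ((A * B : GL (Fin 3) k) : Matrix (Fin 3) (Fin 3) k)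
        = (A : Matrix (Fin 3) (Fin 3) k) * (B : Matrix (Fin 3) (Fin 3) k) := rfl
      rw [hAB, det_mul, hA', hB', one_mul]
  inv_mem' := by
    rintro A ⟨hA, hA'⟩
    have hinv : ((A⁻¹ : GL (Fin 3) k) : Matrix (Fin 3) (Fin 3) k)
        = (A : Matrix (Fin 3) (Fin 3) k)⁻¹ := by
      simp [Matrix.coe_units_inv]
    have h1 : (A : Matrix (Fin 3) (Fin 3) k) * ((A⁻¹ : GL (Fin 3) k) : Matrix (Fin 3) (Fin 3) k)
        = 1 := by
      rw [hinv]
      exact Matrix.mul_nonsing_inv _ (by rw [hA']; exact isUnit_one)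
    constructor
    · calc ((A⁻¹ : GL (Fin 3) k) : Matrix (Fin 3) (Fin 3) k)ᵀ * Q *
            ((A⁻¹ : GL (Fin 3) k) : Matrix (Fin 3) (Fin 3) k)
          = ((A⁻¹ : GL (Fin 3) k) : Matrix (Fin 3) (Fin 3) k)ᵀ *
            ((A : Matrix (Fin 3) (Fin 3) k)ᵀ * Q * (A : Matrix (Fin 3) (Fin 3) k)) *
            ((A⁻¹ : GL (Fin 3) k) : Matrix (Fin 3) (Fin 3) k) := by rw [hA]
        _ = ((A : Matrix (Fin 3) (Fin 3) k) *
              ((A⁻¹ : GL (Fin 3) k) : Matrix (Fin 3) (Fin 3) k))ᵀ * Q *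
            ((A : Matrix (Fin 3) (Fin 3) k) *
              ((A⁻¹ : GL (Fin 3) k) : Matrix (Fin 3) (Fin 3) k)) := by
            rw [transpose_mul]; noncomm_ring
        _ = Q := by rw [h1]; simp
    · rw [hinv, Matrix.det_nonsing_inv, hA']; simp

namespace Icosahedral

/-- The double transposition `(0 1)(2 3)`. -/
def involution : Equiv.Perm (Fin 5) :=
  ⟨![1, 0, 3, 2, 4], ![1, 0, 3, 2, 4], by decide, by decide⟩

/-- The three-cycle `(0 3 2)`. -/
def threeCycle : Equiv.Perm (Fin 5) :=
  ⟨![3, 1, 0, 2, 4], ![2, 1, 3, 0, 4], by decide, by decide⟩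

/-- The five-cycle `(0 1 2 3 4)`. -/
def fiveCycle : Equiv.Perm (Fin 5) :=
  ⟨![1, 2, 3, 4, 0], ![4, 0, 1, 2, 3], by decide, by decide⟩

theorem exists_word_of_even :
    ∀ g : Equiv.Perm (Fin 5), Equiv.Perm.sign g = 1 →
      ∃ (i : Fin 5) (j l : Fin 2) (m : Fin 3),
        g = fiveCycle ^ (i : ℕ) * involution ^ (j : ℕ) *
          (threeCycle * involution * threeCycle⁻¹) ^ (l : ℕ) * threeCycle ^ (m : ℕ) := by
  decide +kernel

variable {k : Type} [Field k]

section Trace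

/-- The Cayley–Hamilton identity for `3 × 3` matrices, in terms of the adjugate. -/
theorem adjugate_eq_sq_sub (M : Matrix (Fin 3) (Fin 3) k) :
    M.adjugate = M * M - M.trace • M + M.adjugate.trace • 1 := by
  ext i j
  fin_cases i <;> fin_cases j <;>
    simp [adjugate_fin_three, mul_apply, trace, Fin.sum_univ_three] <;> ring

theorem isSquare_five_of_pow_five_eq_one {Q M : Matrix (Fin 3) (Fin 3) k} (hQ : IsUnit Q.det)
    (hM : Mᵀ * Q * M = Q) (hdet : M.det = 1) (h5 : M ^ 5 = 1) (hne : M ≠ 1) :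
    ∃ x : k, x ^ 2 = 5 := by
  have hadj : M * M.adjugate = 1 := by rw [mul_adjugate, hdet, one_smul]
  have hadj' : M.adjugate = Q⁻¹ * Mᵀ * Q := by
    have h : Q⁻¹ * Mᵀ * Q * M = 1 := by
      rw [Matrix.mul_assoc Q⁻¹, Matrix.mul_assoc Q⁻¹, hM, nonsing_inv_mul _ hQ]
    calc M.adjugate = Q⁻¹ * Mᵀ * Q * M * M.adjugate := by rw [h, Matrix.one_mul]
      _ = Q⁻¹ * Mᵀ * Q := by rw [Matrix.mul_assoc _ M, hadj, Matrix.mul_one]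
  have htr : M.adjugate.trace = M.trace := by
    rw [hadj', trace_mul_comm, ← Matrix.mul_assoc, mul_nonsing_inv _ hQ, Matrix.one_mul,
      trace_transpose]
  obtain ⟨u, hu⟩ : ∃ u : k, M.trace = u + 1 := ⟨M.trace - 1, by ring⟩
  have hch : M ^ 3 = (u + 1) • M ^ 2 - (u + 1) • M + 1 := by
    have h := hadj
    rw [adjugate_eq_sq_sub M, htr, hu, Matrix.mul_add, Matrix.mul_sub, Matrix.mul_smul,
      Matrix.mul_smul, Matrix.mul_one] at h
    rw [← h]
    simp only [pow_succ, pow_zero, Matrix.one_mul, Matrix.mul_assoc]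
    abel
  have hch4 : M ^ 4 = (u + 1) • M ^ 3 - (u + 1) • M ^ 2 + M := by
    rw [pow_succ, hch, Matrix.add_mul, Matrix.sub_mul, Matrix.smul_mul, Matrix.smul_mul,
      Matrix.one_mul, ← pow_succ, ← pow_two, hch]
  have hch5 : M ^ 5 = (u + 1) • M ^ 4 - (u + 1) • M ^ 3 + M ^ 2 := by
    rw [pow_succ, hch4, Matrix.add_mul, Matrix.sub_mul, Matrix.smul_mul, Matrix.smul_mul,
      ← pow_succ, ← pow_succ, ← pow_two, hch4]
  have key : (u ^ 2 + u - 1) • (M ^ 3 - M ^ 2) = 0 := by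
    have h : M ^ 5 - 1 = (u ^ 2 + u - 1) • (M ^ 3 - M ^ 2) := by
      have h3 : (1 : Matrix (Fin 3) (Fin 3) k) = M ^ 3 - (u + 1) • M ^ 2 + (u + 1) • M := by
        rw [hch]; abel
      rw [h3, hch5, hch4]
      module
    rw [← h, h5, sub_self]
  have hne' : M ^ 3 - M ^ 2 ≠ 0 := by
    intro h
    apply hne
    have h32 : M ^ 3 = M ^ 2 := sub_eq_zero.mp h
    calc M = M ^ 3 * M ^ 3 := by rw [← pow_add, pow_succ, h5, Matrix.one_mul]
      _ = M ^ 2 * M ^ 3 := by rw [h32]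
      _ = 1 := by rw [← pow_add, h5]
  have hu0 : u ^ 2 + u - 1 = 0 := (smul_eq_zero.mp key).resolve_right hne'
  exact ⟨2 * u + 1, by linear_combination 4 * hu0⟩

end Trace

section Diagonalization

/-- A form of square determinant preserved by a copy of the alternating group on four letters
is equivalent to `⟨1, 1, 1⟩`. -/
theorem exists_orthonormal_of_tetrahedral (h2 : (2 : k) ≠ 0)
    {Q A B T : Matrix (Fin 3) (Fin 3) k} {d : k} (hd : d ≠ 0) (hQ : Q.det = d ^ 2)
    (hAQ : Aᵀ * Q * A = Q) (hBQ : Bᵀ * Q * B = Q) (hTQ : Tᵀ * Q * T = Q)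
    (hA : A * A = 1) (hB : B * B = 1) (hAB : A * B = B * A)
    (hTA : T * A = B * T) (hTB : T * B = A * B * T) (hT : T * (T * T) = 1) (hA1 : A ≠ 1) :
    ∃ P : Matrix (Fin 3) (Fin 3) k, IsUnit P.det ∧ Pᵀ * Q * P = 1 := by
  have hTAB : T * (A * B) = A * T := by
    rw [← Matrix.mul_assoc, hTA, Matrix.mul_assoc, hTB, ← Matrix.mul_assoc, ← Matrix.mul_assoc,
      ← hAB, Matrix.mul_assoc A, hB, Matrix.mul_one]
  have inv {M : Matrix (Fin 3) (Fin 3) k} (hM : Mᵀ * Q * M = Q) (x y : Fin 3 → k) :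
      (M *ᵥ x) ⬝ᵥ Q *ᵥ (M *ᵥ y) = x ⬝ᵥ Q *ᵥ y := by
    conv_rhs => rw [← hM]
    rw [← mulVec_mulVec, ← mulVec_mulVec, dotProduct_mulVec x, vecMul_transpose]
  have conj_zero {X Y X' Y' : Matrix (Fin 3) (Fin 3) k} (hX : T * X = X' * T)
      (hY : T * Y = Y' * T) (h : X * Y = 0) : X' * Y' = 0 := by
    have hXY : X' * Y' * T = 0 := by
      rw [Matrix.mul_assoc, ← hY, ← Matrix.mul_assoc, ← hX, Matrix.mul_assoc, h, Matrix.mul_zero]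
    calc X' * Y' = X' * Y' * T * (T * T) := by rw [Matrix.mul_assoc _ T, hT, Matrix.mul_one]
      _ = 0 := by rw [hXY, Matrix.zero_mul]
  have hne : (1 + A) * (1 - B) ≠ 0 := by
    intro h
    have e1 : (1 + B) * (1 - A * B) = 0 := by
      refine conj_zero ?_ ?_ h
      · rw [Matrix.mul_add, Matrix.add_mul, hTA, Matrix.mul_one, Matrix.one_mul]
      · rw [Matrix.mul_sub, Matrix.sub_mul, hTB, Matrix.mul_one, Matrix.one_mul]
    have e2 : (1 + A * B) * (1 - A) = 0 := by
      refine conj_zero ?_ ?_ e1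
      · rw [Matrix.mul_add, Matrix.add_mul, hTB, Matrix.mul_one, Matrix.one_mul]
      · rw [Matrix.mul_sub, Matrix.sub_mul, hTAB, Matrix.mul_one, Matrix.one_mul]
    have hBAB : B * (A * B) = A := by rw [hAB, ← Matrix.mul_assoc, hB, Matrix.one_mul]
    have hABA : A * B * A = B := by rw [hAB, Matrix.mul_assoc, hA, Matrix.mul_one]
    simp only [Matrix.add_mul, Matrix.mul_sub, Matrix.one_mul, Matrix.mul_one, hBAB] at e1
    simp only [Matrix.add_mul, Matrix.mul_sub, Matrix.one_mul, Matrix.mul_one, hABA] at e2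
    have h3 : (2 : k) • (1 - A) = 0 := by
      calc _ = (1 + B - (A * B + A)) + (1 + A * B - (A + B)) := by module
        _ = 0 := by rw [e1, e2, add_zero]
    exact hA1 (sub_eq_zero.mp ((smul_eq_zero.mp h3).resolve_left h2)).symm
  obtain ⟨v, hv⟩ : ∃ v, ((1 + A) * (1 - B)) *ᵥ v ≠ 0 := by
    by_contra! h
    exact hne (Matrix.ext_of_mulVec_single fun i => (h _).trans (zero_mulVec _).symm)
  obtain ⟨e, he0, hAe, hBe⟩ : ∃ e : Fin 3 → k, e ≠ 0 ∧ A *ᵥ e = e ∧ B *ᵥ e = -e := by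
    refine ⟨_, hv, ?_, ?_⟩
    · rw [mulVec_mulVec, ← Matrix.mul_assoc, Matrix.mul_add, hA, Matrix.mul_one, add_comm A]
    · rw [mulVec_mulVec, ← neg_mulVec]
      congr 1
      have h1 : B * (1 + A) = (1 + A) * B := by
        rw [Matrix.mul_add, Matrix.add_mul, hAB, Matrix.mul_one, Matrix.one_mul]
      rw [← Matrix.mul_assoc, h1, Matrix.mul_assoc, Matrix.mul_sub, hB, Matrix.mul_one,
        ← Matrix.mul_neg, neg_sub]
  obtain ⟨f, hf⟩ : ∃ f, f = T *ᵥ e := ⟨_, rfl⟩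
  obtain ⟨g, hg⟩ : ∃ g, g = T *ᵥ f := ⟨_, rfl⟩
  have hTg : T *ᵥ g = e := by rw [hg, hf, mulVec_mulVec, mulVec_mulVec, Matrix.mul_assoc, hT, one_mulVec]
  have hAf : A *ᵥ f = -f := by
    rw [hf, mulVec_mulVec, ← hTAB, ← mulVec_mulVec, ← mulVec_mulVec, hBe, mulVec_neg, hAe,
      mulVec_neg]
  have hBf : B *ᵥ f = f := by rw [hf, mulVec_mulVec, ← hTA, ← mulVec_mulVec, hAe]
  have hAg : A *ᵥ g = -g := by
    rw [hg, mulVec_mulVec, ← hTAB, ← mulVec_mulVec, ← mulVec_mulVec, hBf, hAf, mulVec_neg]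
  have hBg : B *ᵥ g = -g := by
    rw [hg, mulVec_mulVec, ← hTA, ← mulVec_mulVec, hAf, mulVec_neg]
  have hf0 : f ≠ 0 := by
    rintro rfl
    rw [mulVec_zero] at hg
    rw [hg, mulVec_zero] at hTg
    exact he0 hTg.symm
  have hg0 : g ≠ 0 := by
    rintro rfl
    rw [mulVec_zero] at hTg
    exact he0 hTg.symm
  have ortho {M : Matrix (Fin 3) (Fin 3) k} (hM : Mᵀ * Q * M = Q) {x y : Fin 3 → k}
      (h : (M *ᵥ x) ⬝ᵥ Q *ᵥ (M *ᵥ y) = -(x ⬝ᵥ Q *ᵥ y)) : x ⬝ᵥ Q *ᵥ y = 0 := by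
    rw [inv hM] at h
    have : 2 * (x ⬝ᵥ Q *ᵥ y) = 0 := by linear_combination h
    exact (mul_eq_zero.mp this).resolve_left h2
  have hef : e ⬝ᵥ Q *ᵥ f = 0 := ortho hAQ (by simp [hAe, hAf, mulVec_neg])
  have hfe : f ⬝ᵥ Q *ᵥ e = 0 := ortho hAQ (by simp [hAe, hAf])
  have heg : e ⬝ᵥ Q *ᵥ g = 0 := ortho hAQ (by simp [hAe, hAg, mulVec_neg])
  have hge : g ⬝ᵥ Q *ᵥ e = 0 := ortho hAQ (by simp [hAe, hAg])
  have hfg : f ⬝ᵥ Q *ᵥ g = 0 := ortho hBQ (by simp [hBf, hBg, mulVec_neg])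
  have hgf : g ⬝ᵥ Q *ᵥ f = 0 := ortho hBQ (by simp [hBf, hBg])
  obtain ⟨l, hl⟩ : ∃ l, l = e ⬝ᵥ Q *ᵥ e := ⟨_, rfl⟩
  have hff : f ⬝ᵥ Q *ᵥ f = l := by rw [hf, inv hTQ, hl]
  have hgg : g ⬝ᵥ Q *ᵥ g = l := by rw [hg, inv hTQ, hff]
  let P : Matrix (Fin 3) (Fin 3) k := (Matrix.of ![e, f, g])ᵀ
  have hPmul (x : Fin 3 → k) : P *ᵥ x = x 0 • e + x 1 • f + x 2 • g := by
    ext i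
    simp [P, mulVec, dotProduct, Fin.sum_univ_three]
    ring
  have hPQ : Pᵀ * Q * P = l • 1 := by
    have entry (i j : Fin 3) : (Pᵀ * Q * P) i j = ![e, f, g] i ⬝ᵥ Q *ᵥ ![e, f, g] j := by
      rw [dotProduct_mulVec]
      rfl
    ext i j
    rw [entry]
    fin_cases i <;> fin_cases j <;> simp [hef, hfe, heg, hge, hfg, hgf, ← hl, hff, hgg]
  have hP0 : P.det ≠ 0 := by
    intro h
    obtain ⟨x, hx0, hx⟩ := exists_mulVec_eq_zero_iff.mpr h
    rw [hPmul] at hx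
    have hAx : x 0 • e - x 1 • f - x 2 • g = 0 := by
      have := congrArg (A *ᵥ ·) hx
      simp only [mulVec_add, mulVec_smul, hAe, hAf, hAg, mulVec_zero] at this
      rw [← this]
      module
    have hBx : -x 0 • e + x 1 • f - x 2 • g = 0 := by
      have := congrArg (B *ᵥ ·) hx
      simp only [mulVec_add, mulVec_smul, hBe, hBf, hBg, mulVec_zero] at this
      rw [← this]
      module
    have cancel {c : k} {z : Fin 3 → k} (hz : z ≠ 0) (h : (2 : k) • c • z = 0) : c = 0 :=
      (smul_eq_zero.mp ((smul_eq_zero.mp h).resolve_left h2)).resolve_right hz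
    have c0 : x 0 = 0 := cancel he0 <| by
      calc _ = (x 0 • e + x 1 • f + x 2 • g) + (x 0 • e - x 1 • f - x 2 • g) := by module
        _ = 0 := by rw [hx, hAx, add_zero]
    have c1 : x 1 = 0 := cancel hf0 <| by
      calc _ = (x 0 • e + x 1 • f + x 2 • g) + (-x 0 • e + x 1 • f - x 2 • g) := by module
        _ = 0 := by rw [hx, hBx, add_zero]
    have c2 : x 2 = 0 := by
      rw [c0, c1, zero_smul, zero_smul, zero_add, zero_add] at hx
      exact (smul_eq_zero.mp hx).resolve_right hg0
    exact hx0 (by ext i; fin_cases i <;> simp [c0, c1, c2])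
  have hdet : P.det * d ^ 2 * P.det = l ^ 3 := by
    have := congrArg det hPQ
    simpa [hQ] using this
  have hl0 : l ≠ 0 := by
    rintro rfl
    have : P.det * d ^ 2 * P.det ≠ 0 := 
      mul_ne_zero (mul_ne_zero hP0 (pow_ne_zero _ hd)) hP0
    exact this (by rw [hdet]; ring)
  have hm : (l / (d * P.det)) * (l / (d * P.det)) * l = 1 := by
    field_simp
    linear_combination -hdet
  refine ⟨(l / (d * P.det)) • P, ?_, ?_⟩
  · rw [det_smul]
    exact (mul_ne_zero (pow_ne_zero _ (div_ne_zero hl0 (mul_ne_zero hd hP0))) hP0).isUnit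
  · rw [transpose_smul, Matrix.smul_mul, Matrix.smul_mul, Matrix.mul_smul, hPQ, smul_smul,
      smul_smul, hm, one_smul]

end Diagonalization

section Dodecahedron

/-- The vertices of a dodecahedron (`φ` being the golden ratio), indexed by ordered pairs of
distinct inscribed tetrahedra: `vertex φ x y` lies on the tetrahedron `x`, and its antipode
lies on the tetrahedron `y`. -/
def vertex (φ : k) (x y : Fin 5) : Fin 3 → k :=
  ![![0, ![0, φ - 1, -φ], ![φ, 0, φ - 1], ![1 - φ, -φ, 0], ![-1, 1, 1]],
    ![![0, 1 - φ, φ], 0, ![1 - φ, φ, 0], ![φ, 0, 1 - φ], ![-1, -1, -1]],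
    ![![-φ, 0, 1 - φ], ![φ - 1, -φ, 0], 0, ![0, φ - 1, φ], ![1, 1, -1]],
    ![![φ - 1, φ, 0], ![-φ, 0, φ - 1], ![0, 1 - φ, -φ], 0, ![1, -1, 1]],
    ![![1, -1, -1], ![1, 1, 1], ![-1, -1, 1], ![-1, 1, -1], 0]] x y

theorem eq_of_mulVec_vertex_eq (h2 : (2 : k) ≠ 0) (φ : k) {M N : Matrix (Fin 3) (Fin 3) k}
    (h : ∀ x y, M *ᵥ vertex φ x y = N *ᵥ vertex φ x y) : M = N := by
  have h0 := h 4 0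
  have h1 := h 4 1
  have h2' := h 4 2
  have h3 := h 4 3
  ext i j
  replace h0 := congrFun h0 i
  replace h1 := congrFun h1 i
  replace h2' := congrFun h2' i
  replace h3 := congrFun h3 i
  simp only [vertex, mulVec, dotProduct, Fin.sum_univ_three] at h0 h1 h2' h3
  simp at h0 h1 h2' h3
  apply mul_left_cancel₀ h2
  fin_cases j
  · change 2 * M i 0 = 2 * N i 0
    linear_combination h0 + h1
  · change 2 * M i 1 = 2 * N i 1
    linear_combination h1 + h3
  · change 2 * M i 2 = 2 * N i 2
    linear_combination h1 + h2'

/-- The permutations of the five tetrahedra which are induced by rotations. -/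
def rotationPerms (φ : k) : Subgroup (Equiv.Perm (Fin 5)) where
  carrier := {g | ∃ M ∈ SO3 k 1, ∀ x y,
    (M : Matrix (Fin 3) (Fin 3) k) *ᵥ vertex φ x y = vertex φ (g x) (g y)}
  one_mem' := ⟨1, one_mem _, by simp⟩
  mul_mem' := by
    rintro g h ⟨M, hM, hMg⟩ ⟨N, hN, hNh⟩
    refine ⟨M * N, mul_mem hM hN, fun x y => ?_⟩
    rw [Units.val_mul, ← mulVec_mulVec, hNh, hMg]
    rfl
  inv_mem' := by
    rintro g ⟨M, hM, hMg⟩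
    refine ⟨M⁻¹, inv_mem hM, fun x y => ?_⟩
    have := hMg (g⁻¹ x) (g⁻¹ y)
    rw [Equiv.Perm.coe_inv, Equiv.apply_symm_apply, Equiv.apply_symm_apply] at this
    rw [Equiv.Perm.coe_inv, ← this, mulVec_mulVec, ← Units.val_mul, inv_mul_cancel, Units.val_one, one_mulVec]

theorem mem_rotationPerms {φ : k} {g : Equiv.Perm (Fin 5)} (M : Matrix (Fin 3) (Fin 3) k)
    (hM : Mᵀ * M = 1) (hdet : M.det = 1)
    (h : ∀ x y, M *ᵥ vertex φ x y = vertex φ (g x) (g y)) : g ∈ rotationPerms φ :=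
  ⟨GeneralLinearGroup.mkOfDetNeZero M (by simp [hdet]), ⟨by simpa using hM, by simpa using hdet⟩,
    h⟩

theorem involution_mem (φ : k) : involution ∈ rotationPerms φ := by
  apply mem_rotationPerms !![1, 0, 0; 0, -1, 0; 0, 0, -1]
  · ext i j
    fin_cases i <;> fin_cases j <;> simp [mul_apply, Fin.sum_univ_three]
  · simp [det_fin_three]
  · intro x y
    ext i
    fin_cases x <;> fin_cases y <;> fin_cases i <;>
      simp [involution, vertex, mulVec, dotProduct, Fin.sum_univ_three]

theorem threeCycle_mem (φ : k) : threeCycle ∈ rotationPerms φ := by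
  apply mem_rotationPerms !![0, 0, 1; 1, 0, 0; 0, 1, 0]
  · ext i j
    fin_cases i <;> fin_cases j <;> simp [mul_apply, Fin.sum_univ_three]
  · simp [det_fin_three]
  · intro x y
    ext i
    fin_cases x <;> fin_cases y <;> fin_cases i <;>
      simp [threeCycle, vertex, mulVec, dotProduct, Fin.sum_univ_three]

theorem fiveCycle_mem (h2 : (2 : k) ≠ 0) {φ : k} (hφ : φ ^ 2 = φ + 1) :
    fiveCycle ∈ rotationPerms φ := by
  obtain ⟨t, ht⟩ : ∃ t : k, 2 * t = 1 := ⟨2⁻¹, mul_inv_cancel₀ h2⟩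
  apply mem_rotationPerms
    !![t * φ, t * (φ - 1), t; t * (φ - 1), t, -(t * φ); -t, t * φ, t * (φ - 1)]
  · ext i j
    fin_cases i <;> fin_cases j <;> simp [mul_apply, Fin.sum_univ_three] <;> grind
  · simp [det_fin_three]
    grind
  · intro x y
    ext i
    fin_cases x <;> fin_cases y <;> fin_cases i <;>
      simp [fiveCycle, vertex, mulVec, dotProduct, Fin.sum_univ_three] <;> grind

theorem alternatingGroup_le_rotationPerms (h2 : (2 : k) ≠ 0) {φ : k} (hφ : φ ^ 2 = φ + 1) :
    alternatingGroup (Fin 5) ≤ rotationPerms φ := by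
  intro g hg
  obtain ⟨i, j, l, m, rfl⟩ := exists_word_of_even g (Equiv.Perm.mem_alternatingGroup.mp hg)
  have ha := involution_mem φ
  have ht := threeCycle_mem φ
  exact mul_mem (mul_mem (mul_mem (pow_mem (fiveCycle_mem h2 hφ) _) (pow_mem ha _))
    (pow_mem (mul_mem (mul_mem ht ha) (inv_mem ht)) _)) (pow_mem ht _)

theorem exists_injective_hom (h2 : (2 : k) ≠ 0) {φ : k} (hφ : φ ^ 2 = φ + 1) :
    ∃ f : alternatingGroup (Fin 5) →* GL (Fin 3) k,
      Function.Injective f ∧ ∀ g, f g ∈ SO3 k 1 := by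
  have hex (g : alternatingGroup (Fin 5)) := alternatingGroup_le_rotationPerms h2 hφ g.2
  choose F hF hFv using hex
  let f : alternatingGroup (Fin 5) →* GL (Fin 3) k := MonoidHom.mk' F fun g h => by
    apply Units.ext
    apply eq_of_mulVec_vertex_eq h2 φ
    intro x y
    rw [hFv, Units.val_mul, ← mulVec_mulVec, hFv, hFv]
    rfl
  refine ⟨f, ?_, hF⟩
  rw [← MonoidHom.ker_eq_bot_iff]
  refine (IsSimpleGroup.eq_bot_or_eq_top_of_normal f.ker inferInstance).resolve_right fun h => ?_
  let a : alternatingGroup (Fin 5) := ⟨involution, by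
    rw [Equiv.Perm.mem_alternatingGroup]; decide⟩
  have ha : F a = 1 := MonoidHom.mem_ker.mp (h ▸ Subgroup.mem_top a : a ∈ f.ker)
  have hv := congrFun (hFv a 4 0) 1
  rw [ha] at hv
  simp [a, involution, vertex] at hv
  apply h2
  linear_combination -hv

end Dodecahedron

/-- Transport of rotations along an equivalence of forms. -/
theorem conj_mem_SO3 {Q : Matrix (Fin 3) (Fin 3) k} {P M : GL (Fin 3) k}
    (hP : (P : Matrix (Fin 3) (Fin 3) k)ᵀ * Q * (P : Matrix (Fin 3) (Fin 3) k) = 1)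
    (hM : M ∈ SO3 k 1) : P * M * P⁻¹ ∈ SO3 k Q := by
  obtain ⟨hM1, hM2⟩ := hM
  set R : Matrix (Fin 3) (Fin 3) k := ((P⁻¹ : GL (Fin 3) k) : Matrix (Fin 3) (Fin 3) k) with hR
  have hPR : (P : Matrix (Fin 3) (Fin 3) k) * R = 1 := by
    rw [hR, ← Units.val_mul, mul_inv_cancel, Units.val_one]
  have hQ : Q = Rᵀ * R := by
    calc Q = ((P : Matrix (Fin 3) (Fin 3) k) * R)ᵀ * Q * ((P : Matrix (Fin 3) (Fin 3) k) * R) := by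
          rw [hPR]; simp
      _ = Rᵀ * ((P : Matrix (Fin 3) (Fin 3) k)ᵀ * Q * (P : Matrix (Fin 3) (Fin 3) k)) * R := by
          rw [transpose_mul]; noncomm_ring
      _ = Rᵀ * R := by rw [hP, Matrix.mul_one]
  constructor
  · rw [Units.val_mul, Units.val_mul, ← hR, transpose_mul, transpose_mul]
    calc _ = Rᵀ * ((M : Matrix (Fin 3) (Fin 3) k)ᵀ *
          ((P : Matrix (Fin 3) (Fin 3) k)ᵀ * Q * (P : Matrix (Fin 3) (Fin 3) k)) *
          (M : Matrix (Fin 3) (Fin 3) k)) * R := by noncomm_ring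
      _ = Q := by rw [hP, hM1, Matrix.mul_one, hQ]
  · rw [Units.val_mul, Units.val_mul, ← hR, det_mul, det_mul, hM2, mul_one, ← det_mul, hPR,
      det_one]

end Icosahedral

open Icosahedral

/-- If `char k ≠ 2, 3, 5` and `q` is a nondegenerate ternary quadratic form of discriminant
`1`, then `SO(q)(k)` contains a subgroup isomorphic to the alternating group `A₅` if and
only if `5` is a square in `k` and `q` is equivalent to `q₀ = ⟨1,1,1⟩`. -/
theorem a5_subgroup_iff
    (k : Type) [Field k] (h2 : ringChar k ≠ 2) (h3 : ringChar k ≠ 3) (h5 : ringChar k ≠ 5)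
    (Q : Matrix (Fin 3) (Fin 3) k) (hsymm : Qᵀ = Q)
    (hdisc : ∃ d : k, d ≠ 0 ∧ Q.det = d ^ 2) :
    (∃ H : Subgroup (GL (Fin 3) k), H ≤ SO3 k Q ∧
        Nonempty (H ≃* alternatingGroup (Fin 5))) ↔
    ((∃ x : k, x ^ 2 = 5) ∧
      ∃ P : Matrix (Fin 3) (Fin 3) k, IsUnit P.det ∧ Pᵀ * Q * P = 1) := by
  have h2' : (2 : k) ≠ 0 := Ring.two_ne_zero h2
  obtain ⟨d, hd, hQd⟩ := hdisc
  constructor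
  · rintro ⟨H, hH, ⟨ψ⟩⟩
    let ρ : alternatingGroup (Fin 5) →* Matrix (Fin 3) (Fin 3) k :=
      (Units.coeHom _).comp (H.subtype.comp ψ.symm.toMonoidHom)
    have hρ : Function.Injective ρ :=
      Units.val_injective.comp (Subtype.val_injective.comp ψ.symm.injective)
    have hρQ (g) : (ρ g)ᵀ * Q * ρ g = Q := (hH (ψ.symm g).2).1
    have hρdet (g) : (ρ g).det = 1 := (hH (ψ.symm g).2).2
    let a : alternatingGroup (Fin 5) := ⟨involution, by
      rw [Equiv.Perm.mem_alternatingGroup]; decide⟩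
    let t : alternatingGroup (Fin 5) := ⟨threeCycle, by
      rw [Equiv.Perm.mem_alternatingGroup]; decide⟩
    let c : alternatingGroup (Fin 5) := ⟨fiveCycle, by
      rw [Equiv.Perm.mem_alternatingGroup]; decide⟩
    let b := t * a * t⁻¹
    have hne {g : alternatingGroup (Fin 5)} (hg : g ≠ 1) : ρ g ≠ 1 := fun h =>
      hg (hρ (h.trans (map_one ρ).symm))
    constructor
    · refine isSquare_five_of_pow_five_eq_one (Q := Q) (M := ρ c) ?_ (hρQ c) (hρdet c) ?_ (hne ?_)
      · rw [hQd]
        exact (pow_ne_zero 2 hd).isUnit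
      · rw [← map_pow, show c ^ 5 = 1 by decide, map_one]
      · decide
    · refine exists_orthonormal_of_tetrahedral h2' hd hQd (hρQ a) (hρQ b) (hρQ t)
        ?_ ?_ ?_ ?_ ?_ ?_ (hne (by decide)) <;>
        simp only [← map_mul, ← map_one ρ] <;> congr 1 <;> decide
  · rintro ⟨⟨x, hx⟩, P, hPdet, hP⟩
    have hφ : ((1 + x) / 2) ^ 2 = (1 + x) / 2 + 1 := by
      field_simp
      linear_combination hx
    obtain ⟨f, hf, hfSO⟩ := exists_injective_hom h2' hφ
    let p : GL (Fin 3) k := GeneralLinearGroup.mkOfDetNeZero P hPdet.ne_zero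
    let F := (MulAut.conj p).toMonoidHom.comp f
    have hF : Function.Injective F := (MulAut.conj p).injective.comp hf
    refine ⟨F.range, ?_, ⟨(MonoidHom.ofInjective hF).symm⟩⟩
    rintro _ ⟨g, rfl⟩
    exact conj_mem_SO3 hP (hfSO g)
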